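/- Let x be a natural number and y a prime number such that 7^x = 1 + y + y^2. Then x = 1 and y = 2. -/

import Mathlib

abbrev Eis := QuadraticAlgebra ℤ (-1) (-1)

def eisAl : Eis := ⟨3, 1⟩

theorem eis_mul_re (z w : Eis) : (z * w).re = z.re * w.re - z.im * w.im := by
  simp [QuadraticAlgebra.re_mul]; ring

theorem eis_mul_im (z w : Eis) :
    (z * w).im = z.re * w.im + z.im * w.re - z.im * w.im := by
  simp [QuadraticAlgebra.im_mul]; ring

theorem eis_al6 : eisAl ^ 6 = (⟨37, 360⟩ : Eis) := by
  ext <;> simp [eisAl, pow_succ]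

theorem eis_al5 : eisAl ^ 5 = (⟨62, 149⟩ : Eis) := by
  ext <;> simp [eisAl, pow_succ]

theorem eis_mod (t : ℕ) : ∃ p q : ℤ, (eisAl ^ 6) ^ t = (⟨1 + 12 * p, 24 * q⟩ : Eis) := by
  induction t with
  | zero => exact ⟨0, 0, by rw [pow_zero]; ext <;> rfl⟩
  | succ t ih =>
    obtain ⟨p, q, h⟩ := ih
    refine ⟨3 + 37 * p - 24 * 30 * q, 15 * (1 + 12 * p) + 37 * q - 360 * q, ?_⟩
    rw [pow_succ, h, eis_al6]
    ext
    · rw [eis_mul_re]; ring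
    · rw [eis_mul_im]; ring

theorem eis_mod8 (t : ℕ) : ∃ p q : ℤ,
    (eisAl ^ 6) ^ (2 * t + 1) = (⟨5 + 8 * p, 8 * q⟩ : Eis) := by
  induction t with
  | zero => exact ⟨4, 45, by rw [eis_al6]; ext <;> simp⟩
  | succ t ih =>
    obtain ⟨p, q, h⟩ := ih
    have e : (eisAl ^ 6) ^ 2 = (⟨37 ^ 2 - 360 ^ 2, 2 * 37 * 360 - 360 ^ 2⟩ : Eis) := by
      rw [eis_al6, pow_two]
      ext
      · rw [eis_mul_re]; norm_num
      · rw [eis_mul_im]; norm_num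
    rw [show 2 * (t + 1) + 1 = (2 * t + 1) + 2 by ring, pow_add, h, e]
    refine ⟨((5 + 8 * p) * (37 ^ 2 - 360 ^ 2) - 5) / 8 - q * (2 * 37 * 360 - 360 ^ 2),
      (5 + 8 * p) * (2 * 37 * 45 - 45 * 360) + q * (37 ^ 2 - 360 ^ 2)
        - q * (2 * 37 * 360 - 360 ^ 2), ?_⟩
    ext
    · rw [eis_mul_re]; dsimp only; omega
    · rw [eis_mul_im]; dsimp only; ring

theorem eis_val (t : ℕ) (ht : 0 < t) : ∃ (k : ℕ) (p q : ℤ),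
    (eisAl ^ 6) ^ t = (⟨1 + 4 * 2 ^ k * (1 + 2 * p), 8 * 2 ^ k * q⟩ : Eis) := by
  induction t using Nat.strong_induction_on with
  | _ t ih =>
    rcases Nat.even_or_odd' t with ⟨s, rfl | rfl⟩
    · obtain ⟨k, p, q, h⟩ := ih s (by omega) (by omega)
      refine ⟨k + 1, p + 2 ^ k * (1 + 2 * p) ^ 2 - 4 * 2 ^ k * q ^ 2,
        (1 + 4 * 2 ^ k * (1 + 2 * p)) * q - 4 * 2 ^ k * q ^ 2, ?_⟩
      rw [two_mul, pow_add, h]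
      ext
      · rw [eis_mul_re]; dsimp only; ring
      · rw [eis_mul_im]; dsimp only; ring
    · obtain ⟨p, q, h⟩ := eis_mod8 s
      exact ⟨0, p, q, by rw [h]; ext <;> simp <;> ring⟩

theorem eis_im_ne (t : ℕ) (ht : 0 < t) : (eisAl ^ (6 * t + 1)).im ≠ 1 := by
  obtain ⟨k, p, q, h⟩ := eis_val t ht
  rw [pow_succ, pow_mul, h, eis_mul_im]
  simp only [eisAl]
  intro h
  have h2 : (4 * 2 ^ k : ℤ) * (1 + 2 * p + 4 * q) = 0 := by linarith
  have : (4 * 2 ^ k : ℤ) ≠ 0 := by positivity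
  have := (mul_eq_zero.mp h2).resolve_left this
  omega

theorem eis_desc (n : ℕ) : ∀ a b : ℤ, a ^ 2 - a * b + b ^ 2 = 7 ^ n →
    (n = 0 ∨ (7 ∣ a - 3 * b ∧ ¬ 7 ∣ b)) →
    ∃ u : Eis, u.re ^ 2 - u.re * u.im + u.im ^ 2 = 1 ∧ (⟨a, b⟩ : Eis) = u * eisAl ^ n := by
  induction n with
  | zero => intro a b h _; exact ⟨⟨a, b⟩, by simpa using h, by simp⟩
  | succ n ih =>
    intro a b h h2
    obtain ⟨⟨c, hc⟩, hb⟩ := h2.resolve_left (by omega)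
    obtain rfl : a = 3 * b + 7 * c := by linarith
    have hN : (b + 2 * c) ^ 2 - (b + 2 * c) * (-c) + (-c) ^ 2 = 7 ^ n := by
      rw [pow_succ (7 : ℤ) n] at h; linarith
    obtain ⟨u, hu, e⟩ := ih (b + 2 * c) (-c) hN (by
      rcases Nat.eq_zero_or_pos n with h0 | h0
      · exact Or.inl h0
      · right
        have h7 : (7 : ℤ) ∣ 7 ^ n := dvd_pow_self _ (by omega)
        rw [← hN] at h7
        have h8 : (7 : ℤ) ∣ b * (b + 5 * c) := by
          have := h7.sub (Dvd.intro (c ^ 2) rfl : (7 : ℤ) ∣ 7 * c ^ 2)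
          have e : b * (b + 5 * c) =
              (b + 2 * c) ^ 2 - (b + 2 * c) * (-c) + (-c) ^ 2 - 7 * c ^ 2 := by ring
          rw [e]; exact this
        have h9 := ((by norm_num : Prime (7 : ℤ)).dvd_or_dvd h8).resolve_left hb
        omega)
    refine ⟨u, hu, ?_⟩
    rw [pow_succ, ← mul_assoc, ← e]
    ext
    · rw [eis_mul_re]; simp only [eisAl]; ring
    · rw [eis_mul_im]; simp only [eisAl]; ring

theorem eis_main (n : ℕ) (h6 : n % 6 = 1 ∨ n % 6 = 5) (a b : ℤ) (hb : b = 1 ∨ b = -1)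
    (h : a ^ 2 - a * b + b ^ 2 = 7 ^ n) (h7 : 7 ∣ a - 3 * b) : n = 1 := by
  obtain ⟨u, hu, e⟩ := eis_desc n a b h (Or.inr ⟨h7, by omega⟩)
  have him : b = u.re * (eisAl ^ n).im + u.im * (eisAl ^ n).re - u.im * (eisAl ^ n).im := by
    rw [← eis_mul_im, ← e]
  obtain ⟨p, q, hpq⟩ := eis_mod (n / 6)
  have hne := eis_im_ne (n / 6)
  obtain ⟨v, w⟩ := u
  dsimp only at hu him
  have b1 : v ≤ 1 := by nlinarith [sq_nonneg (v - 2 * w)]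
  have b2 : -1 ≤ v := by nlinarith [sq_nonneg (v - 2 * w)]
  have b3 : w ≤ 1 := by nlinarith [sq_nonneg (w - 2 * v)]
  have b4 : -1 ≤ w := by nlinarith [sq_nonneg (w - 2 * v)]
  rcases h6 with h6 | h6
  · have hn : n = 6 * (n / 6) + 1 := by omega
    rw [← hn] at hne
    have hA : eisAl ^ n = (⟨1 + 12 * p, 24 * q⟩ : Eis) * eisAl := by
      conv_lhs => rw [hn]
      rw [pow_succ, pow_mul, hpq]
    have h1 : (eisAl ^ n).re = (1 + 12 * p) * 3 - 24 * q := by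
      rw [hA, eis_mul_re]; simp [eisAl]
    have h2 : (eisAl ^ n).im = (1 + 12 * p) + 24 * q * 2 := by
      rw [hA, eis_mul_im]; simp only [eisAl]; ring
    rw [h1, h2] at him
    rw [h2] at hne
    interval_cases v <;> interval_cases w <;> omega
  · have hn : n = 6 * (n / 6) + 5 := by omega
    have hA : eisAl ^ n = (⟨1 + 12 * p, 24 * q⟩ : Eis) * ⟨62, 149⟩ := by
      conv_lhs => rw [hn]
      rw [pow_add, pow_mul, hpq, eis_al5]
    have h1 : (eisAl ^ n).re = (1 + 12 * p) * 62 - 24 * q * 149 := by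
      rw [hA, eis_mul_re]
    have h2 : (eisAl ^ n).im = (1 + 12 * p) * 149 - 24 * q * 87 := by
      rw [hA, eis_mul_im]; ring
    rw [h1, h2] at him
    interval_cases v <;> interval_cases w <;> omega

theorem prime_mod3 (y : ℕ) (hy : y.Prime) (h3 : y % 3 = 2) (t : ℕ) (h : y ∣ t ^ 2 + t + 1) :
    False := by
  haveI := Fact.mk hy
  have h0 : (t : ZMod y) ^ 2 + t + 1 = 0 := by
    have := (ZMod.natCast_eq_zero_iff (t ^ 2 + t + 1) y).2 h
    simpa using this
  have hc : (t : ZMod y) ^ 3 = 1 := by linear_combination ((t : ZMod y) - 1) * h0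
  have hne : (t : ZMod y) ≠ 0 := by
    intro hz; rw [hz] at h0; simp at h0
  have hf := ZMod.pow_card_sub_one_eq_one hne
  have hd : y - 1 = 3 * (y / 3) + 1 := by omega
  rw [hd, pow_succ, pow_mul, hc, one_pow, one_mul] at hf
  rw [hf] at h0
  have h3' : ((3 : ℕ) : ZMod y) = 0 := by push_cast; linear_combination h0
  have := (ZMod.natCast_eq_zero_iff 3 y).1 h3'
  have := (Nat.prime_dvd_prime_iff_eq hy Nat.prime_three).1 this
  omega

/-- If `x` is a positive natural and `y` a prime with `7^x = 1 + y + y^2`,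
then `x = 1` and `y = 2`. -/
theorem stmt_8 (x y : ℕ) (hx : 0 < x) (hy : y.Prime)
    (h : 7 ^ x = 1 + y + y ^ 2) :
    x = 1 ∧ y = 2 := by
  have hy2 := hy.two_le
  suffices hx1 : x = 1 by
    subst hx1
    exact ⟨rfl, by nlinarith⟩
  have hodd : x % 2 = 1 := by
    by_contra hc
    obtain ⟨k, rfl⟩ : ∃ k, x = 2 * k := ⟨x / 2, by omega⟩
    rw [mul_comm, pow_mul] at h
    have h1 : y < 7 ^ k := lt_of_pow_lt_pow_left₀ 2 (by positivity) (by omega)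
    have h2 : 7 ^ k < y + 1 := lt_of_pow_lt_pow_left₀ 2 (by positivity) (by nlinarith)
    omega
  have hm7 : (1 + y + y ^ 2) % 7 = 0 := by
    rw [← h]; exact Nat.mod_eq_zero_of_dvd (dvd_pow_self _ (by omega))
  have hy7 : y % 7 = 2 ∨ y % 7 = 4 := by
    have : y % 7 < 7 := Nat.mod_lt _ (by norm_num)
    rw [Nat.add_mod, Nat.add_mod 1 y, Nat.pow_mod] at hm7
    interval_cases y % 7 <;> simp_all
  have hthree : x % 3 ≠ 0 := by
    intro hc
    obtain ⟨k, rfl⟩ : ∃ k, x = 3 * k := ⟨x / 3, by omega⟩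
    rw [mul_comm, pow_mul] at h
    have hk : 7 ≤ 7 ^ k := by
      calc 7 = 7 ^ 1 := by norm_num
        _ ≤ 7 ^ k := Nat.pow_le_pow_right (by norm_num) (by omega)
    have ht3 : 7 ^ k % 3 = 1 := by simp [Nat.pow_mod]
    have hy3 : y % 3 = 2 := by
      have h33 : (1 + y + y ^ 2) % 3 = 1 := by rw [← h]; simp [Nat.pow_mod]
      have : y % 3 ≠ 0 := by
        intro h0
        have := (Nat.prime_dvd_prime_iff_eq Nat.prime_three hy).1 (Nat.dvd_of_mod_eq_zero h0)
        omega
      have : y % 3 < 3 := Nat.mod_lt _ (by norm_num)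
      rw [Nat.add_mod, Nat.add_mod 1 y, Nat.pow_mod] at h33
      interval_cases y % 3 <;> simp_all
    obtain ⟨s, hs⟩ : ∃ s, 7 ^ k = s + 1 := ⟨7 ^ k - 1, by omega⟩
    have hprod : s * ((7 ^ k) ^ 2 + 7 ^ k + 1) = y * (y + 1) := by
      rw [hs] at h ⊢; nlinarith
    have hd : y ∣ s * ((7 ^ k) ^ 2 + 7 ^ k + 1) := ⟨_, hprod⟩
    rcases hy.dvd_mul.1 hd with hd | hd
    · have := Nat.le_of_dvd (by omega) hd
      have hlt : (7 ^ k) ^ 2 + 7 ^ k + 1 > y + 1 := by nlinarith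
      nlinarith
    · exact prime_mod3 y hy hy3 _ hd
  have hz : (7 : ℤ) ^ x = 1 + y + y ^ 2 := by exact_mod_cast h
  rcases hy7 with h7 | h7
  · exact eis_main x (by omega) (y + 1) 1 (by simp) (by rw [hz]; ring) (by omega)
  · exact eis_main x (by omega) y (-1) (by simp) (by rw [hz]; ring) (by omega)
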